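/- arXiv:1401.2874 — 3 statements merged into one kernel-verified Lean document; each statement's English description precedes it below -/
import Mathlib

section
/- Let (G, L, k, p) be a graphic instance of capacitated k-supplier with outliers in which the capacity function L is constant on ℱ, and let S ⊆ ℱ. Suppose that (i) G is connected, (ii) d(u,u') ≥ 6 for all distinct u, u' ∈ S, (iii) every vertex of G is at distance at most 5 from S, and (iv) the relaxed linear program LP'_{k,p}(G, L, S), obtained from LP_{k,p}(G, L, S) by dropping the upper bounds y_u ≤ 1, has a feasible solution. Then the instance admits a soft distance-13 solution. -/
open Finset

open scoped Classical

/-- A graphic instance of capacitated `k`-supplier with outliers: a finite bipartite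
graph `G` with client vertices `Cs`, facility vertices `Fs` (partitioning the vertex set),
and edges only between the two parts. -/
def IsGraphicInstance {V : Type*} [Fintype V] (G : SimpleGraph V)
    (Cs Fs : Finset V) : Prop :=
  Disjoint Cs Fs ∧ Cs ∪ Fs = Finset.univ ∧
    ∀ u v, G.Adj u v → (u ∈ Cs ∧ v ∈ Fs) ∨ (u ∈ Fs ∧ v ∈ Cs)

/-- A soft distance-`τ` solution: `p` clients `C` are served by facilities opened with
multiplicities `g` (summing to `k`), with each location `u` serving at most `L u * g u`
clients, each within distance `τ`. -/
def IsSoftSolution {V : Type*} [Fintype V] [DecidableEq V] (G : SimpleGraph V)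
    (Cs Fs : Finset V) (L : V → ℕ) (k p τ : ℕ)
    (C : Finset V) (g : V → ℕ) (φ : V → V) : Prop :=
  C ⊆ Cs ∧ C.card = p ∧ (∑ u ∈ Fs, g u = k) ∧
    (∀ v ∈ C, φ v ∈ Fs) ∧
    (∀ u ∈ Fs, (C.filter (fun v => φ v = u)).card ≤ L u * g u) ∧
    (∀ v ∈ C, G.edist v (φ v) ≤ (τ : ℕ∞))

/-- The constraints of the relaxed linear program `LP'_{k,p}(G, L, S)`, obtained from
`LP_{k,p}(G, L, S)` by dropping the upper bounds `y_u ≤ 1`. -/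
def LPSatRelaxed {V : Type*} [Fintype V] (G : SimpleGraph V) (Cs Fs : Finset V)
    (L : V → ℕ) (k p : ℕ) (S : Finset V) (x : V → V → ℝ) (y : V → ℝ) : Prop :=
  (∀ u, 0 ≤ y u) ∧
    (∀ u v, 0 ≤ x u v ∧ x u v ≤ 1) ∧
    (∑ u ∈ Fs, y u = k) ∧
    (∑ u ∈ Fs, ∑ v ∈ Cs, x u v = p) ∧
    (∀ u ∈ Fs, ∀ v ∈ Cs, x u v ≤ y u) ∧
    (∀ u ∈ Fs, ∑ v ∈ Cs, x u v ≤ (L u : ℝ) * y u) ∧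
    (∀ v ∈ Cs, ∑ u ∈ Fs, x u v ≤ 1) ∧
    (∀ s ∈ S, 1 ≤ ∑ u ∈ Fs.filter (fun u => G.edist u s ≤ 2), y u) ∧
    (∀ u ∈ Fs, ∀ v ∈ Cs, ¬ G.Adj v u → x u v = 0)

/-- A capacitated form of Hall's theorem with deficiency: `p` elements of `A` can be assigned to
elements of `B` along `R`, respecting the capacities `b`, if every `X ⊆ A` satisfies the
corresponding cut condition. -/
theorem exists_capacitated_assignment {α β : Type*} (A : Finset α) (B : Finset β)
    (R : α → β → Prop) (b : β → ℕ) (p : ℕ)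
    (h : ∀ X ⊆ A, p ≤ (A \ X).card + ∑ u ∈ B.filter (fun u => ∃ v ∈ X, R v u), b u) (b₀ : β) :
    ∃ C ⊆ A, C.card = p ∧ ∃ φ : α → β, (∀ v ∈ C, φ v ∈ B ∧ R v (φ v)) ∧
      ∀ u ∈ B, (C.filter (fun v => φ v = u)).card ≤ b u := by
  have hp : p ≤ A.card := by simpa using h ∅ (empty_subset _)
  let t : A → Finset ((Σ _ : β, ℕ) ⊕ ℕ) := fun v =>
    ((B.filter (R v)).sigma (fun u => range (b u))).disjSum (range (A.card - p))
  obtain ⟨m, hm, hmt⟩ := (Finset.all_card_le_biUnion_card_iff_exists_injective t).1 (by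
    intro s
    rcases s.eq_empty_or_nonempty with rfl | ⟨v₀, hv₀⟩
    · simp
    have hsub : ((B.filter (fun u => ∃ v ∈ s.map (Function.Embedding.subtype _), R v u)).sigma
        (fun u => range (b u))).disjSum (range (A.card - p)) ⊆ s.biUnion t := by
      intro z hz
      rw [mem_biUnion]
      rcases z with ⟨u, i⟩ | j
      · simp only [inl_mem_disjSum, mem_sigma, mem_filter, mem_map] at hz
        obtain ⟨⟨hu, _, ⟨v, hv, rfl⟩, hR⟩, hi⟩ := hz
        refine ⟨v, hv, ?_⟩
        simp only [t, inl_mem_disjSum, mem_sigma, mem_filter]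
        exact ⟨⟨hu, hR⟩, hi⟩
      · refine ⟨v₀, hv₀, ?_⟩
        simpa [t] using hz
    refine le_trans ?_ (card_le_card hsub)
    have hX : s.map (Function.Embedding.subtype _) ⊆ A := by
      intro v hv
      obtain ⟨w, -, rfl⟩ := mem_map.1 hv
      exact w.2
    have h1 := h _ hX
    have h2 := card_sdiff_add_card_eq_card hX
    rw [card_map] at h2
    rw [card_disjSum, card_sigma]
    simp only [card_range]
    omega)
  let m' : α → (Σ _ : β, ℕ) ⊕ ℕ := fun v => if hv : v ∈ A then m ⟨v, hv⟩ else Sum.inr 0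
  have hm' : ∀ v ∈ A, ∀ w ∈ A, m' v = m' w → v = w := by
    intro v hv w hw hvw
    simp only [m', hv, hw, dite_true] at hvw
    exact congrArg Subtype.val (hm hvw)
  have hmt' : ∀ v ∈ A, m' v ∈ ((B.filter (R v)).sigma (fun u => range (b u))).disjSum
      (range (A.card - p)) := by
    intro v hv
    simp only [m', hv, dite_true]
    exact hmt ⟨v, hv⟩
  have hcard : p ≤ (A.filter (fun v => (m' v).isLeft)).card := by
    have h1 : (A.filter (fun v => ¬ (m' v).isLeft)).card ≤
        ((range (A.card - p)).map (Function.Embedding.inr (α := Σ _ : β, ℕ))).card := by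
      refine card_le_card_of_injOn m' ?_ ?_
      · intro v hv
        have hv := mem_filter.1 hv
        have h2 := hmt' v hv.1
        rcases hz : m' v with z | j
        · simp [hz] at hv
        · rw [hz] at h2
          simpa using h2
      · intro v hv w hw
        exact hm' v (mem_filter.1 hv).1 w (mem_filter.1 hw).1
    have h2 := card_filter_add_card_filter_not (s := A) (fun v => ((m' v).isLeft : Prop))
    rw [card_map, card_range] at h1
    omega
  obtain ⟨C, hC, hCp⟩ := exists_subset_card_eq hcard
  have hCA : ∀ v ∈ C, ∃ z, m' v = Sum.inl z := fun v hv =>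
    Sum.isLeft_iff.1 (mem_filter.1 (hC hv)).2
  have hCA' : ∀ v ∈ C, v ∈ A := fun v hv => (mem_filter.1 (hC hv)).1
  refine ⟨C, hCA', hCp, fun v => Sum.elim (fun z => z.1) (fun _ => b₀) (m' v), ?_, ?_⟩
  · intro v hv
    obtain ⟨z, hz⟩ := hCA v hv
    have h2 := hmt' v (hCA' v hv)
    rw [hz] at h2
    simp only [inl_mem_disjSum, mem_sigma, mem_filter] at h2
    simpa only [hz, Sum.elim_inl] using h2.1
  · intro u _
    rw [← card_range (b u)]
    refine card_le_card_of_injOn (fun v => Sum.elim (fun z => z.2) (fun _ => 0) (m' v)) ?_ ?_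
    · intro v hv
      obtain ⟨hv, hu⟩ := mem_filter.1 hv
      obtain ⟨z, hz⟩ := hCA v hv
      have h2 := hmt' v (hCA' v hv)
      rw [hz] at h2
      simp only [inl_mem_disjSum, mem_sigma, mem_filter] at h2
      simp only [hz, Sum.elim_inl] at hu
      subst hu
      simpa [hz] using h2.2
    · intro v hv w hw hvw
      obtain ⟨hv, hu⟩ := mem_filter.1 hv
      obtain ⟨hw, hu'⟩ := mem_filter.1 hw
      obtain ⟨z, hz⟩ := hCA v hv
      obtain ⟨z', hz'⟩ := hCA w hw
      refine hm' v (hCA' v hv) w (hCA' w hw) ?_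
      simp only [hz, hz', Sum.elim_inl] at hu hu' hvw ⊢
      rw [Sigma.ext (hu.trans hu'.symm) (heq_of_eq hvw)]

/-- Real weights at least one with integral total on a rooted tree (given by a parent map) can be
made integral by moving at most one unit from each node to its parent. -/
theorem exists_integral_parent_transfer {α : Type*} (r : α) (par : α → α) (rank : α → ℕ)
    (hr : par r = r) (T : Finset α) (hrT : r ∈ T)
    (hpar : ∀ s ∈ T, s ≠ r → par s ∈ T ∧ rank (par s) < rank s)
    (Y : α → ℝ) (z : ℤ) (hz : ∑ s ∈ T, Y s = z) :
    ∃ (f : α → ℝ) (g : α → ℤ), (∀ s, 0 ≤ f s ∧ f s ≤ 1) ∧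
      ∀ s ∈ T, (g s : ℝ) = Y s - f s + ∑ c ∈ T.filter (fun c => par c = s), f c := by
  induction hn : T.card generalizing T Y z with
  | zero => exact absurd (card_eq_zero.1 hn) (ne_empty_of_mem hrT)
  | succ n ih =>
    rcases (T.erase r).eq_empty_or_nonempty with hT | hT
    · have hT' : T = {r} := by rw [← insert_erase hrT, hT, insert_empty_eq]
      subst hT'
      refine ⟨0, fun _ => z, by simp, ?_⟩
      intro s hs
      rw [mem_singleton] at hs
      subst hs
      simpa using hz.symm
    · obtain ⟨v, hv, hmax⟩ := exists_max_image _ rank hT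
      obtain ⟨hvr, hvT⟩ := mem_erase.1 hv
      obtain ⟨hwT, hrank⟩ := hpar v hvT hvr
      have hwv : par v ≠ v := fun h => by rw [h] at hrank; exact lt_irrefl _ hrank
      have hnochild : ∀ c ∈ T, par c ≠ v := by
        intro c hc h
        by_cases hcr : c = r
        · subst hcr
          exact hvr (h.symm.trans hr)
        · have h1 := (hpar c hc hcr).2
          have h2 := hmax c (mem_erase.2 ⟨hcr, hc⟩)
          rw [h] at h1
          omega
      obtain ⟨f, g, hf, hg⟩ := ih (T.erase v) (mem_erase.2 ⟨hvr.symm, hrT⟩)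
        (fun s hs hsr => ⟨mem_erase.2 ⟨hnochild s (mem_erase.1 hs).2,
          (hpar s (mem_erase.1 hs).2 hsr).1⟩, (hpar s (mem_erase.1 hs).2 hsr).2⟩)
        (fun s => Y s + if s = par v then Int.fract (Y v) else 0) (z - ⌊Y v⌋)
        (by
          rw [sum_add_distrib, sum_ite_eq', if_pos (mem_erase.2 ⟨hwv, hwT⟩)]
          have h1 := add_sum_erase T Y hvT
          have h2 := Int.floor_add_fract (Y v)
          push_cast
          linarith)
        (by rw [card_erase_of_mem hvT]; omega)
      refine ⟨fun s => if s = v then Int.fract (Y v) else f s,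
        fun s => if s = v then ⌊Y v⌋ else g s, ?_, ?_⟩
      · intro s
        by_cases hs : s = v
        · simp only [hs, if_true]
          exact ⟨Int.fract_nonneg _, (Int.fract_lt_one _).le⟩
        · simpa only [hs, if_false] using hf s
      · intro s hs
        by_cases hsv : s = v
        · subst hsv
          have h2 := Int.floor_add_fract (Y s)
          rw [filter_eq_empty_iff.2 (fun c hc => hnochild c hc)]
          simp only [if_true, sum_empty]
          linarith
        · simp only [hsv, if_false]
          rw [hg s (mem_erase.2 ⟨hsv, hs⟩), sum_filter, sum_filter, ← add_sum_erase T _ hvT]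
          have h3 : ∑ c ∈ T.erase v, (if par c = s then (if c = v then Int.fract (Y v) else f c)
              else 0) = ∑ c ∈ T.erase v, if par c = s then f c else 0 := by
            refine sum_congr rfl fun c hc => ?_
            rw [if_neg (mem_erase.1 hc).1]
          rw [h3]
          simp only [if_true, eq_comm (a := s) (b := par v)]
          ring

theorem IsGraphicInstance.even_dist {V : Type*} [Fintype V] {G : SimpleGraph V}
    {Cs Fs : Finset V} (h : IsGraphicInstance G Cs Fs) (hconn : G.Connected) (u v : V) :
    Even (G.dist u v) ↔ (u ∈ Fs ↔ v ∈ Fs) := by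
  have hside : ∀ a b, G.Adj a b → (a ∈ Fs ↔ b ∉ Fs) := by
    intro a b hab
    have hdis : ∀ x, x ∈ Cs → x ∉ Fs := fun x hx => disjoint_left.1 h.1 hx
    rcases h.2.2 a b hab with ⟨ha, hb⟩ | ⟨ha, hb⟩
    · simp [hdis a ha, hb]
    · simp [hdis b hb, ha]
  obtain ⟨w, hw⟩ := hconn.exists_walk_length_eq_dist u v
  rw [← hw]
  clear hw
  induction w with
  | nil => simp
  | cons hab w ih =>
    rw [SimpleGraph.Walk.length_cons, Nat.even_add_one]
    have := hside _ _ hab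
    tauto

theorem SimpleGraph.Connected.exists_dist_eq_of_le {V : Type*} {G : SimpleGraph V}
    (hconn : G.Connected) (u v : V) (n : ℕ) (hn : n ≤ G.dist u v) :
    ∃ w, G.dist u w = n ∧ G.dist w v + n = G.dist u v := by
  obtain ⟨w, hw⟩ := hconn.exists_walk_length_eq_dist u v
  have h1 := G.dist_le (w.take n)
  have h2 := G.dist_le (w.drop n)
  have h3 := hconn.dist_triangle (u := u) (v := w.getVert n) (w := v)
  rw [SimpleGraph.Walk.take_length] at h1
  rw [SimpleGraph.Walk.drop_length] at h2
  refine ⟨w.getVert n, ?_, ?_⟩ <;> omega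

/-- The weights `y` on the facilities can be replaced by integral weights on the separated
set `S` so that no mass travels further than distance `12`. -/
theorem exists_integral_opening {V : Type*} [Fintype V] {G : SimpleGraph V}
    {Cs Fs : Finset V} (hinst : IsGraphicInstance G Cs Fs) {S : Finset V} (hSF : S ⊆ Fs)
    (hconn : G.Connected)
    (hsep : ∀ u ∈ S, ∀ u' ∈ S, u ≠ u' → 6 ≤ G.dist u u')
    (hcov : ∀ v : V, ∃ s ∈ S, G.dist v s ≤ 5) (y : V → ℝ) (hy : ∀ u, 0 ≤ y u) (k : ℕ)
    (hk : ∑ u ∈ Fs, y u = k)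
    (hS : ∀ s ∈ S, 1 ≤ ∑ u ∈ Fs.filter (fun u => G.dist u s ≤ 2), y u) :
    ∃ g : V → ℕ, ∑ u ∈ Fs, g u = k ∧ ∀ B ⊆ Fs, ∑ u ∈ B, y u ≤
      ∑ u ∈ Fs.filter (fun u => ∃ b ∈ B, G.dist b u ≤ 12), (g u : ℝ) := by
  have htri : ∀ a b c, G.dist a c ≤ G.dist a b + G.dist b c := fun a b c => hconn.dist_triangle
  have hcov4 : ∀ v ∈ Fs, ∃ s ∈ S, G.dist v s ≤ 4 := by
    intro v hv
    obtain ⟨s, hs, hd⟩ := hcov v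
    have h1 := (hinst.even_dist hconn v s).2 (by simp [hv, hSF hs])
    refine ⟨s, hs, ?_⟩
    by_contra h
    have : G.dist v s = 5 := by omega
    rw [this] at h1
    exact absurd h1 (by decide)
  obtain ⟨r, hr⟩ : ∃ r, r ∈ S :=
    let ⟨s, hs, _⟩ := hcov hconn.nonempty.some; ⟨s, hs⟩
  have hpar : ∀ s, ∃ s', (s = r → s' = r) ∧
      (s ∈ S → s' ∈ S ∧ G.dist s s' ≤ 10 ∧ (s ≠ r → G.dist s' r < G.dist s r)) := by
    intro s
    by_cases hsr : s = r
    · exact ⟨r, fun _ => rfl, fun _ => ⟨hr, by simp [hsr], fun h => absurd hsr h⟩⟩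
    by_cases hs : s ∈ S
    · obtain ⟨w, hw, hw'⟩ := hconn.exists_dist_eq_of_le s r 6 (hsep s hs r hr hsr)
      have hwF : w ∈ Fs := by
        have := (hinst.even_dist hconn s w).1 (by rw [hw]; decide)
        exact this.1 (hSF hs)
      obtain ⟨s', hs', hd⟩ := hcov4 w hwF
      have h1 := htri s w s'
      have h2 := htri s' w r
      have h3 := G.dist_comm (u := s') (v := w)
      exact ⟨s', fun h => absurd h hsr, fun _ => ⟨hs', by omega, fun _ => by omega⟩⟩
    · exact ⟨r, fun h => absurd h hsr, fun h => absurd h hs⟩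
  choose par hpr hpar using hpar
  have hcl : ∀ u, ∃ s, u ∈ Fs → s ∈ S ∧ G.dist u s ≤ 4 ∧ ∀ s' ∈ S, G.dist u s' ≤ 2 → s' = s := by
    intro u
    by_cases hu : u ∈ Fs
    · by_cases h : ∃ s ∈ S, G.dist u s ≤ 2
      · obtain ⟨s, hs, hd⟩ := h
        refine ⟨s, fun _ => ⟨hs, by omega, fun s' hs' hd' => ?_⟩⟩
        by_contra hne
        have h1 := hsep s' hs' s hs hne
        have h2 := htri s' u s
        have h3 := G.dist_comm (u := s') (v := u)
        omega
      · obtain ⟨s, hs, hd⟩ := hcov4 u hu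
        exact ⟨s, fun _ => ⟨hs, hd, fun s' hs' hd' => absurd ⟨s', hs', hd'⟩ h⟩⟩
    · exact ⟨u, fun h => absurd h hu⟩
  choose cl hcl using hcl
  let Y : V → ℝ := fun s => ∑ u ∈ Fs.filter (fun u => cl u = s), y u
  have hYsum : ∑ s ∈ S, Y s = ((k : ℤ) : ℝ) := by
    rw [sum_fiberwise_of_maps_to (fun u hu => (hcl u hu).1), hk]
    simp
  have hball : ∀ s ∈ S, Fs.filter (fun u => G.dist u s ≤ 2) ⊆ Fs.filter (fun u => cl u = s) := by
    intro s hs u hu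
    obtain ⟨hu, hd⟩ := mem_filter.1 hu
    exact mem_filter.2 ⟨hu, ((hcl u hu).2.2 s hs hd).symm⟩
  have hY1 : ∀ s ∈ S, 1 ≤ Y s := fun s hs =>
    (hS s hs).trans (sum_le_sum_of_subset_of_nonneg (hball s hs) fun u _ _ => hy u)
  obtain ⟨f, g, hf, hg⟩ := exists_integral_parent_transfer r par (fun s => G.dist s r)
    (hpr r rfl) S hr (fun s hs hsr => ⟨(hpar s hs).1, (hpar s hs).2.2 hsr⟩) Y k hYsum
  have hg0 : ∀ s ∈ S, 0 ≤ g s := by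
    intro s hs
    have h1 := sum_nonneg (s := S.filter (fun c => par c = s)) (fun c _ => (hf c).1)
    have h2 := hg s hs
    have h3 := hY1 s hs
    have h4 := (hf s).2
    exact_mod_cast (show (0 : ℝ) ≤ g s by linarith)
  have hgS : ∀ T : Finset V, ∑ s ∈ T, (((if s ∈ S then (g s).toNat else 0 : ℕ)) : ℝ) =
      ∑ s ∈ T.filter (· ∈ S), (g s : ℝ) := by
    intro T
    rw [sum_filter]
    refine sum_congr rfl fun s _ => ?_
    by_cases hs : s ∈ S
    · simp only [hs, if_true]
      exact_mod_cast Int.toNat_of_nonneg (hg0 s hs)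
    · simp [hs]
  have hsum : ∀ T ⊆ S, ∑ s ∈ T, (g s : ℝ) =
      ∑ s ∈ T, (Y s - f s) + ∑ c ∈ S.filter (fun c => par c ∈ T), f c := by
    intro T hT
    rw [← sum_fiberwise_of_maps_to (t := T) (g := par) (fun c hc => (mem_filter.1 hc).2),
      ← sum_add_distrib]
    refine sum_congr rfl fun s hs => ?_
    rw [hg s (hT hs), filter_filter]
    congr 2
    ext c
    simp only [mem_filter]
    constructor
    · rintro ⟨hc, rfl⟩
      exact ⟨hc, hs, rfl⟩
    · rintro ⟨hc, -, h⟩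
      exact ⟨hc, h⟩
  refine ⟨fun s => if s ∈ S then (g s).toNat else 0, ?_, ?_⟩
  · have h1 := hgS Fs
    have hFS : Fs.filter (· ∈ S) = S := by
      ext s
      simpa using fun h => hSF h
    rw [hFS, hsum S subset_rfl, sum_sub_distrib, hYsum,
      filter_true_of_mem (fun c hc => (hpar c hc).1)] at h1
    have h2 : (∑ s ∈ Fs, (((if s ∈ S then (g s).toNat else 0 : ℕ)) : ℝ)) = k := by
      rw [h1]
      push_cast
      ring
    exact_mod_cast h2
  · intro B hB
    rw [hgS, filter_filter]
    set T := Fs.filter (fun u => (∃ b ∈ B, G.dist b u ≤ 12) ∧ u ∈ S)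
    have hTS : T ⊆ S := fun s hs => (mem_filter.1 hs).2.2
    have hclT : ∀ b ∈ B, cl b ∈ T := by
      intro b hb
      obtain ⟨h1, h2, -⟩ := hcl b (hB hb)
      exact mem_filter.2 ⟨hSF h1, ⟨b, hb, by omega⟩, h1⟩
    let near : V → Prop := fun s => ∃ b ∈ B, G.dist b s ≤ 2
    have hnear : T.filter near ⊆ S.filter (fun c => par c ∈ T) := by
      intro s hs
      obtain ⟨hs, b, hb, hd⟩ := mem_filter.1 hs
      obtain ⟨h1, h2, -⟩ := hpar s (hTS hs)
      have h3 := htri b s (par s)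
      exact mem_filter.2 ⟨hTS hs, mem_filter.2 ⟨hSF h1, ⟨b, hb, by omega⟩, h1⟩⟩
    have hterm : ∀ s ∈ T, ∑ u ∈ B.filter (fun u => cl u = s), y u ≤
        (Y s - f s) + if near s then f s else 0 := by
      intro s hs
      by_cases hn : near s
      · rw [if_pos hn, sub_add_cancel]
        exact sum_le_sum_of_subset_of_nonneg (filter_subset_filter _ hB) fun u _ _ => hy u
      · rw [if_neg hn, add_zero]
        have hdis : Disjoint (B.filter (fun u => cl u = s))
            (Fs.filter (fun u => G.dist u s ≤ 2)) := by
          rw [disjoint_left]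
          intro u hu hu'
          exact hn ⟨u, (mem_filter.1 hu).1, (mem_filter.1 hu').2⟩
        have h1 : ∑ u ∈ B.filter (fun u => cl u = s) ∪ Fs.filter (fun u => G.dist u s ≤ 2), y u
            ≤ Y s := sum_le_sum_of_subset_of_nonneg
          (union_subset (filter_subset_filter _ hB) (hball s (hTS hs))) fun u _ _ => hy u
        rw [sum_union hdis] at h1
        have h2 := hS s (hTS hs)
        have h3 := (hf s).2
        linarith
    rw [hsum T hTS, ← sum_fiberwise_of_maps_to hclT]
    refine (sum_le_sum hterm).trans ?_
    rw [sum_add_distrib, ← sum_filter]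
    gcongr
    exact fun s _ _ => (hf s).1

/-- Under the assumptions of the rounding lemma with uniform capacities
and feasibility of the relaxed LP, the instance admits a soft distance-13 solution. -/
theorem rounding_13_uniform_soft {V : Type*} [Fintype V] [DecidableEq V]
    (G : SimpleGraph V) (Cs Fs : Finset V) (L : V → ℕ) (k p : ℕ)
    (hinst : IsGraphicInstance G Cs Fs)
    (huniform : ∃ c : ℕ, ∀ u ∈ Fs, L u = c)
    (S : Finset V) (hSF : S ⊆ Fs)
    (hconn : G.Connected)
    (hsep : ∀ u ∈ S, ∀ u' ∈ S, u ≠ u' → 6 ≤ G.edist u u')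
    (hcov : ∀ v : V, ∃ s ∈ S, G.edist v s ≤ 5)
    (hLP : ∃ x y, LPSatRelaxed G Cs Fs L k p S x y) :
    ∃ C g φ, IsSoftSolution G Cs Fs L k p 13 C g φ := by
  obtain ⟨c, hc⟩ := huniform
  obtain ⟨x, y, hy, hx, hk, hp, -, hxL, hx1, hS, hadj⟩ := hLP
  have hdist : ∀ u v (n : ℕ), G.edist u v ≤ n ↔ G.dist u v ≤ n := by
    intro u v n
    rw [← (hconn u v).coe_dist_eq_edist, Nat.cast_le]
  obtain ⟨g, hgk, hg⟩ := exists_integral_opening hinst hSF hconn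
    (fun u hu u' hu' hne => by
      have := hsep u hu u' hu' hne
      rw [← (hconn u u').coe_dist_eq_edist] at this
      exact_mod_cast this)
    (fun v => by
      obtain ⟨s, hs, hd⟩ := hcov v
      exact ⟨s, hs, (hdist v s 5).1 hd⟩)
    y hy k hk
    (fun s hs => by
      have := hS s hs
      simp only [show ∀ u, G.edist u s ≤ 2 ↔ G.dist u s ≤ 2 from fun u => hdist u s 2] at this
      exact this)
  have hcut : ∀ X ⊆ Cs, p ≤ (Cs \ X).card +
      ∑ u ∈ Fs.filter (fun u => ∃ v ∈ X, G.dist v u ≤ 13), L u * g u := by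
    intro X hX
    let B := Fs.filter (fun u => ∃ v ∈ X, G.Adj v u)
    have hout : ∑ u ∈ Fs, ∑ v ∈ Cs \ X, x u v ≤ (Cs \ X).card := by
      rw [sum_comm, card_eq_sum_ones]
      push_cast
      exact sum_le_sum fun v hv => hx1 v (mem_sdiff.1 hv).1
    have hin : ∑ u ∈ Fs, ∑ v ∈ X, x u v ≤ c * ∑ u ∈ B, y u := by
      rw [mul_sum, sum_filter]
      refine sum_le_sum fun u hu => ?_
      split_ifs with h
      · rw [← hc u hu]
        exact (sum_le_sum_of_subset_of_nonneg hX fun v _ _ => (hx u v).1).trans (hxL u hu)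
      · refine (sum_eq_zero fun v hv => hadj u hu v (hX hv) fun hvu => h ⟨v, hv, hvu⟩).le
    have hB : ∑ u ∈ B, y u ≤
        ∑ u ∈ Fs.filter (fun u => ∃ v ∈ X, G.dist v u ≤ 13), (g u : ℝ) := by
      refine (hg B (filter_subset _ _)).trans
        (sum_le_sum_of_subset_of_nonneg ?_ fun u _ _ => Nat.cast_nonneg _)
      intro u hu
      obtain ⟨hu, b, hb, hd⟩ := mem_filter.1 hu
      obtain ⟨-, v, hv, hvb⟩ := mem_filter.1 hb
      have h1 := hconn.dist_triangle (u := v) (v := b) (w := u)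
      rw [SimpleGraph.dist_eq_one_iff_adj.2 hvb] at h1
      exact mem_filter.2 ⟨hu, v, hv, by omega⟩
    have hL : ∑ u ∈ Fs.filter (fun u => ∃ v ∈ X, G.dist v u ≤ 13), ((L u * g u : ℕ) : ℝ) =
        c * ∑ u ∈ Fs.filter (fun u => ∃ v ∈ X, G.dist v u ≤ 13), (g u : ℝ) := by
      rw [mul_sum]
      refine sum_congr rfl fun u hu => ?_
      rw [hc u (mem_filter.1 hu).1, Nat.cast_mul]
    have hsplit : (p : ℝ) = ∑ u ∈ Fs, ∑ v ∈ Cs \ X, x u v + ∑ u ∈ Fs, ∑ v ∈ X, x u v := by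
      rw [← hp, ← sum_add_distrib]
      exact sum_congr rfl fun u _ => (sum_sdiff hX).symm
    have hmul := mul_le_mul_of_nonneg_left hB (Nat.cast_nonneg (α := ℝ) c)
    have : (p : ℝ) ≤ (Cs \ X).card +
        ∑ u ∈ Fs.filter (fun u => ∃ v ∈ X, G.dist v u ≤ 13), ((L u * g u : ℕ) : ℝ) := by
      linarith
    exact_mod_cast this
  obtain ⟨C, hC, hCp, φ, hφ, hload⟩ := exists_capacitated_assignment Cs Fs
    (fun v u => G.dist v u ≤ 13) (fun u => L u * g u) p
    (fun X hX => by convert hcut X hX) hconn.nonempty.some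
  refine ⟨C, g, φ, hC, hCp, hgk, fun v hv => (hφ v hv).1, fun u hu => ?_,
    fun v hv => (hdist _ _ 13).2 (hφ v hv).2⟩
  convert hload u hu
end

section
/- For every integer r ≥ 2 there exist a graphic instance (G, L, k, p) of capacitated k-supplier with outliers and a set S ⊆ ℱ such that: G is connected; d(u,u') ≥ 6 for all distinct u, u' ∈ S; LP_{k,p}(G, L, S) has a feasible solution; and yet the instance admits no distance-r solution. -/
open Finset

open scoped Classical

/-- A distance-`τ` solution `(C, F, φ)` of a graphic instance. -/
def IsSolution {V : Type*} [Fintype V] [DecidableEq V] (G : SimpleGraph V)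
    (Cs Fs : Finset V) (L : V → ℕ) (k p τ : ℕ)
    (C F : Finset V) (φ : V → V) : Prop :=
  C ⊆ Cs ∧ F ⊆ Fs ∧ C.card = p ∧ F.card = k ∧
    (∀ v ∈ C, φ v ∈ F) ∧
    (∀ u ∈ F, (C.filter (fun v => φ v = u)).card ≤ L u) ∧
    (∀ v ∈ C, G.edist v (φ v) ≤ (τ : ℕ∞))

/-- A preskeleton: a subset of facilities satisfying the separation and injection
properties with respect to some distance-1 solution. -/
def IsPreskeleton {V : Type*} [Fintype V] [DecidableEq V] (G : SimpleGraph V)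
    (Cs Fs : Finset V) (L : V → ℕ) (k p : ℕ) (S : Finset V) : Prop :=
  S ⊆ Fs ∧
    (∀ u ∈ S, ∀ u' ∈ S, u ≠ u' → 6 ≤ G.edist u u') ∧
    ∃ C F φ, IsSolution G Cs Fs L k p 1 C F φ ∧
      ∃ f : V → V, Set.InjOn f ↑S ∧ ∀ u ∈ S, f u ∈ F ∧ G.edist u (f u) ≤ 2

/-- A skeleton: a preskeleton whose witnessing distance-1 solution moreover satisfies the
covering property. -/
def IsSkeleton {V : Type*} [Fintype V] [DecidableEq V] (G : SimpleGraph V)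
    (Cs Fs : Finset V) (L : V → ℕ) (k p : ℕ) (S : Finset V) : Prop :=
  S ⊆ Fs ∧
    (∀ u ∈ S, ∀ u' ∈ S, u ≠ u' → 6 ≤ G.edist u u') ∧
    ∃ C F φ, IsSolution G Cs Fs L k p 1 C F φ ∧
      (∀ u ∈ F, ∃ s ∈ S, G.edist u s ≤ 4) ∧
      ∃ f : V → V, Set.InjOn f ↑S ∧ ∀ u ∈ S, f u ∈ F ∧ G.edist u (f u) ≤ 2


/-- The constraints of the linear program `LP_{k,p}(G, L, S)` for an explicit pair `(x, y)`. -/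
def LPSat {V : Type*} [Fintype V] (G : SimpleGraph V) (Cs Fs : Finset V)
    (L : V → ℕ) (k p : ℕ) (S : Finset V) (x : V → V → ℝ) (y : V → ℝ) : Prop :=
  (∀ u, 0 ≤ y u ∧ y u ≤ 1) ∧
    (∀ u v, 0 ≤ x u v ∧ x u v ≤ 1) ∧
    (∑ u ∈ Fs, y u = k) ∧
    (∑ u ∈ Fs, ∑ v ∈ Cs, x u v = p) ∧
    (∀ u ∈ Fs, ∀ v ∈ Cs, x u v ≤ y u) ∧
    (∀ u ∈ Fs, ∑ v ∈ Cs, x u v ≤ (L u : ℝ) * y u) ∧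
    (∀ v ∈ Cs, ∑ u ∈ Fs, x u v ≤ 1) ∧
    (∀ s ∈ S, 1 ≤ ∑ u ∈ Fs.filter (fun u => G.edist u s ≤ 2), y u) ∧
    (∀ u ∈ Fs, ∀ v ∈ Cs, ¬ G.Adj v u → x u v = 0)

/-- Feasibility of the linear program `LP_{k,p}(G, L, S)`. -/
def LPFeasible {V : Type*} [Fintype V] (G : SimpleGraph V) (Cs Fs : Finset V)
    (L : V → ℕ) (k p : ℕ) (S : Finset V) : Prop :=
  ∃ x y, LPSat G Cs Fs L k p S x y

/-- The blow-up of a path: vertices are adjacent iff their levels are consecutive. -/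
def levelGraph {V : Type*} (lev : V → ℕ) : SimpleGraph V where
  Adj u v := lev u = lev v + 1 ∨ lev v = lev u + 1
  symm := ⟨fun _ _ h => h.symm⟩
  loopless := ⟨fun _ h => by omega⟩

namespace levelGraph

variable {V : Type*} {lev : V → ℕ}

theorem adj_iff {u v : V} :
    (levelGraph lev).Adj u v ↔ lev u = lev v + 1 ∨ lev v = lev u + 1 := Iff.rfl

theorem lev_le_add_length {u v : V} (w : (levelGraph lev).Walk u v) :
    lev u ≤ lev v + w.length ∧ lev v ≤ lev u + w.length := by
  induction w with
  | nil => simp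
  | cons h w ih =>
    rw [adj_iff] at h
    simp only [SimpleGraph.Walk.length_cons]
    omega

theorem lev_le_add_of_edist_le {u v : V} {t : ℕ} (h : (levelGraph lev).edist u v ≤ (t : ℕ∞)) :
    lev u ≤ lev v + t ∧ lev v ≤ lev u + t := by
  have hne : (levelGraph lev).edist u v ≠ ⊤ := ne_top_of_le_ne_top (ENat.natCast_ne_top t) h
  obtain ⟨w, hw⟩ := SimpleGraph.exists_walk_of_edist_ne_top hne
  rw [← hw] at h
  have := lev_le_add_length w
  have : w.length ≤ t := by exact_mod_cast h
  omega

theorem connected {N : ℕ} (hN : 0 < N) (hle : ∀ v, lev v ≤ N) (hex : ∀ i ≤ N, ∃ v, lev v = i) :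
    (levelGraph lev).Connected := by
  obtain ⟨b, hb⟩ := hex 0 (Nat.zero_le _)
  have main : ∀ i ≤ N, ∃ v, lev v = i ∧ (levelGraph lev).Reachable b v := by
    intro i
    induction i with
    | zero => exact fun _ => ⟨b, hb, .refl _⟩
    | succ i ih =>
      intro hi
      obtain ⟨v, hv, hr⟩ := ih (by omega)
      obtain ⟨w, hw⟩ := hex (i + 1) hi
      exact ⟨w, hw, hr.trans (SimpleGraph.Adj.reachable (adj_iff.2 (by omega)))⟩
  have hreach : ∀ v, (levelGraph lev).Reachable b v := by
    intro v
    obtain ⟨w, hw, hr⟩ : ∃ w, (lev v = lev w + 1 ∨ lev w = lev v + 1) ∧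
        (levelGraph lev).Reachable b w := by
      rcases Nat.eq_zero_or_pos (lev v) with h | h
      · obtain ⟨w, hw, hr⟩ := main 1 hN
        exact ⟨w, by omega, hr⟩
      · obtain ⟨w, hw, hr⟩ := main (lev v - 1) (by have := hle v; omega)
        exact ⟨w, by omega, hr⟩
    exact hr.trans (SimpleGraph.Adj.reachable (adj_iff.2 hw.symm))
  exact { preconnected := fun u v => (hreach u).symm.trans (hreach v), nonempty := ⟨b⟩ }

theorem edist_le_two {u v w : V} (huv : lev u = lev v)
    (hw : lev u = lev w + 1 ∨ lev w = lev u + 1) : (levelGraph lev).edist u v ≤ 2 := by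
  have h₁ : (levelGraph lev).Adj u w := adj_iff.2 hw
  have h₂ : (levelGraph lev).Adj w v := adj_iff.2 (by omega)
  exact SimpleGraph.edist_le (SimpleGraph.Walk.cons h₁ (SimpleGraph.Walk.cons h₂ .nil))

end levelGraph

/-- There is a finite set with a level function whose level sets have prescribed sizes. -/
theorem exists_levels (N : ℕ) (m : ℕ → ℕ) :
    ∃ (n : ℕ) (lev : Fin n → ℕ), (∀ v, lev v ≤ N) ∧
      ∀ i ≤ N, (univ.filter (fun v => lev v = i)).card = m i := by
  let e := finSigmaFinEquiv (m := N + 1) (n := fun i => m i)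
  refine ⟨_, fun v => (e.symm v).1, fun v => Nat.lt_succ_iff.1 (e.symm v).1.2, fun i hi => ?_⟩
  have hi' : i < N + 1 := by omega
  rw [← Fintype.card_fin (m i), ← Finset.card_univ]
  symm
  refine Finset.card_bij (fun a _ => e ⟨⟨i, hi'⟩, a⟩) ?_ ?_ ?_
  · intro a _
    simp
  · intro a _ b _ h
    have := e.injective h
    simpa using this
  · intro v hv
    simp only [mem_filter, mem_univ, true_and] at hv
    obtain ⟨⟨j, a⟩, rfl⟩ := e.surjective v
    simp only [Equiv.symm_apply_apply] at hv
    subst hv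
    exact ⟨a, mem_univ _, rfl⟩

section Gap

variable {V : Type*} [Fintype V] {lev : V → ℕ}

theorem isGraphicInstance_levelGraph :
    IsGraphicInstance (levelGraph lev) (univ.filter fun v => Odd (lev v))
      (univ.filter fun v => Even (lev v)) := by
  refine ⟨?_, ?_, ?_⟩
  · rw [Finset.disjoint_left]
    intro v h₁ h₂
    simp only [mem_filter, mem_univ, true_and] at h₁ h₂
    exact Nat.not_even_iff_odd.2 h₁ h₂
  · ext v
    simpa using (Nat.even_or_odd (lev v)).symm
  · intro u v h
    rw [levelGraph.adj_iff] at h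
    simp only [mem_filter, mem_univ, true_and, Nat.odd_iff, Nat.even_iff]
    omega

theorem sum_ite_lev_eq (P : ℕ → Prop) [DecidablePred P] {j : ℕ} (hj : P j) :
    ∑ v ∈ univ.filter (fun v => P (lev v)), (if lev v = j then (1 : ℝ) else 0) =
      (univ.filter (fun v => lev v = j)).card := by
  rw [Finset.sum_boole, Finset.filter_filter]
  congr 2
  ext v
  simp only [mem_filter, mem_univ, true_and, and_iff_right_iff_imp]
  rintro rfl
  exact hj

theorem lpFeasible_levelGraph {N M : ℕ} (hN : 8 ≤ N) (hNe : Even N) (hM : 0 < M)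
    (h0 : (univ.filter fun v => lev v = 0).card = 2)
    (h1 : (univ.filter fun v => lev v = 1).card = 3 * M)
    (hN1 : (univ.filter fun v => lev v = N - 1).card = 3 * M)
    (hNN : (univ.filter fun v => lev v = N).card = 2)
    {S : Finset V} (hS : ∀ s ∈ S, lev s = 0 ∨ lev s = N) :
    LPFeasible (levelGraph lev) (univ.filter fun v => Odd (lev v))
      (univ.filter fun v => Even (lev v))
      (fun v => if lev v = 0 ∨ lev v = N then 2 * M else 0) 3 (6 * M) S := by
  let ind : ℕ → V → ℝ := fun j v => if lev v = j then 1 else 0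
  have hind : ∀ j v, ind j v = 0 ∧ lev v ≠ j ∨ ind j v = 1 ∧ lev v = j := by
    intro j v
    by_cases h : lev v = j <;> simp [ind, h]
  have hodd : Odd (N - 1) := by
    rw [Nat.even_iff] at hNe
    rw [Nat.odd_iff]
    omega
  have s0 : ∑ u ∈ univ.filter (fun v => Even (lev v)), ind 0 u = 2 :=
    (sum_ite_lev_eq (lev := lev) (P := Even) (j := 0) Even.zero).trans (by rw [h0]; push_cast; ring)
  have sN : ∑ u ∈ univ.filter (fun v => Even (lev v)), ind N u = 2 :=
    (sum_ite_lev_eq (lev := lev) (P := Even) hNe).trans (by rw [hNN]; push_cast; ring)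
  have s1 : ∑ u ∈ univ.filter (fun v => Odd (lev v)), ind 1 u = 3 * M :=
    (sum_ite_lev_eq (lev := lev) (P := Odd) odd_one).trans (by rw [h1]; push_cast; ring)
  have sN1 : ∑ u ∈ univ.filter (fun v => Odd (lev v)), ind (N - 1) u = 3 * M :=
    (sum_ite_lev_eq (lev := lev) (P := Odd) hodd).trans (by rw [hN1]; push_cast; ring)
  have hrow : ∀ u, ∑ v ∈ univ.filter (fun v => Odd (lev v)),
      (ind 0 u * ind 1 v + ind N u * ind (N - 1) v) / 2 =
        (ind 0 u + ind N u) * (3 * M / 2) := by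
    intro u
    rw [← Finset.sum_div, Finset.sum_add_distrib, ← Finset.mul_sum, ← Finset.mul_sum, s1, sN1]
    ring
  refine ⟨fun u v => (ind 0 u * ind 1 v + ind N u * ind (N - 1) v) / 2,
    fun u => 3 / 4 * (ind 0 u + ind N u), ?_, ?_, ?_, ?_, ?_, ?_, ?_, ?_, ?_⟩
  · intro u
    rcases hind 0 u with ⟨h, h'⟩ | ⟨h, h'⟩ <;> rcases hind N u with ⟨k, k'⟩ | ⟨k, k'⟩ <;>
      first | omega | (simp only [h, k]; norm_num)
  · intro u v
    rcases hind 0 u with ⟨h, h'⟩ | ⟨h, h'⟩ <;> rcases hind N u with ⟨k, k'⟩ | ⟨k, k'⟩ <;>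
      rcases hind 1 v with ⟨l, l'⟩ | ⟨l, l'⟩ <;> rcases hind (N - 1) v with ⟨q, q'⟩ | ⟨q, q'⟩ <;>
      first | omega | (simp only [h, k, l, q]; norm_num)
  · rw [← Finset.mul_sum, Finset.sum_add_distrib, s0, sN]
    norm_num
  · simp only [hrow]
    rw [← Finset.sum_mul, Finset.sum_add_distrib, s0, sN]
    push_cast
    ring
  · intro u _ v _
    rcases hind 0 u with ⟨h, h'⟩ | ⟨h, h'⟩ <;> rcases hind N u with ⟨k, k'⟩ | ⟨k, k'⟩ <;>
      rcases hind 1 v with ⟨l, l'⟩ | ⟨l, l'⟩ <;> rcases hind (N - 1) v with ⟨q, q'⟩ | ⟨q, q'⟩ <;>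
      first | omega | (simp only [h, k, l, q]; norm_num)
  · intro u _
    rw [hrow]
    rcases hind 0 u with ⟨h, h'⟩ | ⟨h, h'⟩ <;> rcases hind N u with ⟨k, k'⟩ | ⟨k, k'⟩ <;>
      simp only [h, k, h', k', or_true, true_or, or_self, if_true, if_false] <;>
      first | omega | (push_cast; linarith)
  · intro v _
    rw [← Finset.sum_div, Finset.sum_add_distrib, ← Finset.sum_mul, ← Finset.sum_mul, s0, sN]
    rcases hind 1 v with ⟨l, l'⟩ | ⟨l, l'⟩ <;> rcases hind (N - 1) v with ⟨q, q'⟩ | ⟨q, q'⟩ <;>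
      first | omega | (simp only [l, q]; norm_num)
  · intro s hs
    have hy : ∀ u, 0 ≤ 3 / 4 * (ind 0 u + ind N u) := by
      intro u
      rcases hind 0 u with ⟨h, -⟩ | ⟨h, -⟩ <;> rcases hind N u with ⟨k, -⟩ | ⟨k, -⟩ <;>
        simp only [h, k] <;> norm_num
    obtain ⟨j, hsj, hj, hjc, w, hw⟩ : ∃ j, lev s = j ∧ (j = 0 ∨ j = N) ∧
        (univ.filter fun v => lev v = j).card = 2 ∧ ∃ w, lev s = lev w + 1 ∨ lev w = lev s + 1 := by
      rcases hS s hs with h | h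
      · obtain ⟨w, hw⟩ := Finset.card_pos.1 (by rw [h1]; omega :
          0 < (univ.filter fun v => lev v = 1).card)
        simp only [mem_filter, mem_univ, true_and] at hw
        exact ⟨0, h, .inl rfl, h0, w, by omega⟩
      · obtain ⟨w, hw⟩ := Finset.card_pos.1 (by rw [hN1]; omega :
          0 < (univ.filter fun v => lev v = N - 1).card)
        simp only [mem_filter, mem_univ, true_and] at hw
        exact ⟨N, h, .inr rfl, hNN, w, by omega⟩
    calc (1 : ℝ) ≤ ∑ u ∈ univ.filter (fun v => lev v = j), (3 / 4 : ℝ) := by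
          rw [Finset.sum_const, hjc]
          norm_num
      _ ≤ ∑ u ∈ univ.filter (fun v => lev v = j), 3 / 4 * (ind 0 u + ind N u) := by
          refine Finset.sum_le_sum fun u hu => ?_
          simp only [mem_filter, mem_univ, true_and] at hu
          rcases hind 0 u with ⟨h, h'⟩ | ⟨h, h'⟩ <;> rcases hind N u with ⟨k, k'⟩ | ⟨k, k'⟩ <;>
            first | omega | (simp only [h, k]; norm_num)
      _ ≤ _ := by
          refine Finset.sum_le_sum_of_subset_of_nonneg ?_ fun u _ _ => hy u
          intro u hu
          simp only [mem_filter, mem_univ, true_and] at hu ⊢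
          refine ⟨?_, levelGraph.edist_le_two (w := w) (by omega) (by omega)⟩
          rcases hj with rfl | rfl <;> rw [hu]
          · exact Even.zero
          · exact hNe
  · intro u _ v _ hadj
    rw [levelGraph.adj_iff] at hadj
    rcases hind 0 u with ⟨h, h'⟩ | ⟨h, h'⟩ <;> rcases hind N u with ⟨k, k'⟩ | ⟨k, k'⟩ <;>
      rcases hind 1 v with ⟨l, l'⟩ | ⟨l, l'⟩ <;> rcases hind (N - 1) v with ⟨q, q'⟩ | ⟨q, q'⟩ <;>
      first | omega | (simp only [h, k, l, q]; norm_num)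

/-- Only few clients are close to a given end of the blown-up path. -/
theorem card_le_of_close {N M r : ℕ} (hrN : r + 2 ≤ N) (hNe : Even N)
    (hle : ∀ v, lev v ≤ N)
    (h1 : (univ.filter fun v => lev v = 1).card = 3 * M)
    (hN1 : (univ.filter fun v => lev v = N - 1).card = 3 * M)
    (hmid : ∀ i, 2 ≤ i → i ≤ N - 2 → (univ.filter fun v => lev v = i).card = 1)
    {u : V} (hu : lev u = 0 ∨ lev u = N) {D : Finset V}
    (hD : ∀ v ∈ D, Odd (lev v) ∧ lev u ≤ lev v + r ∧ lev v ≤ lev u + r) :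
    D.card ≤ 3 * M + N := by
  have hM : (univ.filter fun v => 2 ≤ lev v ∧ lev v ≤ N - 2).card ≤ N := by
    refine (Finset.card_le_card_of_injOn (t := range N) lev ?_ ?_).trans_eq (card_range N)
    · intro v hv
      simp only [coe_filter, mem_univ, true_and, Set.mem_ofPred_eq] at hv
      simp only [coe_range, Set.mem_Iio]
      omega
    · intro v hv w hw h
      simp only [coe_filter, mem_univ, true_and, Set.mem_ofPred_eq] at hv
      exact Finset.card_le_one.1 (hmid (lev v) hv.1 hv.2).le v (by simp) w (by simp [h])
  obtain ⟨j, hj, hsub⟩ : ∃ j, (univ.filter fun v => lev v = j).card = 3 * M ∧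
      ∀ v ∈ D, lev v = j ∨ 2 ≤ lev v ∧ lev v ≤ N - 2 := by
    rw [Nat.even_iff] at hNe
    rcases hu with h | h
    · refine ⟨1, h1, fun v hv => ?_⟩
      obtain ⟨h₁, h₂, h₃⟩ := hD v hv
      rw [Nat.odd_iff] at h₁
      omega
    · refine ⟨N - 1, hN1, fun v hv => ?_⟩
      obtain ⟨h₁, h₂, h₃⟩ := hD v hv
      rw [Nat.odd_iff] at h₁
      have := hle v
      omega
  have : D ⊆ (univ.filter fun v => lev v = j) ∪
      univ.filter fun v => 2 ≤ lev v ∧ lev v ≤ N - 2 := by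
    intro v hv
    simpa using hsub v hv
  have := (Finset.card_le_card this).trans (Finset.card_union_le _ _)
  omega

theorem not_isSolution_levelGraph [DecidableEq V] {N M r : ℕ} (hrN : r + 2 ≤ N) (hNe : Even N)
    (hNM : N < M) (hle : ∀ v, lev v ≤ N)
    (h1 : (univ.filter fun v => lev v = 1).card = 3 * M)
    (hN1 : (univ.filter fun v => lev v = N - 1).card = 3 * M)
    (hmid : ∀ i, 2 ≤ i → i ≤ N - 2 → (univ.filter fun v => lev v = i).card = 1)
    (C F : Finset V) (φ : V → V) :
    ¬ IsSolution (levelGraph lev) (univ.filter fun v => Odd (lev v))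
      (univ.filter fun v => Even (lev v))
      (fun v => if lev v = 0 ∨ lev v = N then 2 * M else 0) 3 (6 * M) r C F φ := by
  rintro ⟨hC, -, hp, hk, hφ, hL, hd⟩
  have pair : ∀ u u', u ≠ u' → lev u = lev u' → (lev u = 0 ∨ lev u = N) →
      (C.filter fun v => φ v = u).card = 2 * M → (C.filter fun v => φ v = u').card = 2 * M →
      False := by
    intro u u' hne hlev hu hc hc'
    have hdisj : Disjoint (C.filter fun v => φ v = u) (C.filter fun v => φ v = u') := by
      rw [Finset.disjoint_left]
      intro v hv hv'
      exact hne ((mem_filter.1 hv).2.symm.trans (mem_filter.1 hv').2)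
    have := card_le_of_close hrN hNe hle h1 hN1 hmid hu
      (D := (C.filter fun v => φ v = u) ∪ C.filter fun v => φ v = u') (by
        intro v hv
        rw [mem_union, mem_filter, mem_filter] at hv
        have hvC : v ∈ C := by tauto
        have hlv : lev (φ v) = lev u := by
          rcases hv with h | h <;> rw [h.2]
          exact hlev.symm
        have hodd := hC hvC
        simp only [mem_filter, mem_univ, true_and] at hodd
        have := levelGraph.lev_le_add_of_edist_le (hd v hvC)
        rw [hlv] at this
        exact ⟨hodd, this.2, this.1⟩)
    rw [Finset.card_union_of_disjoint hdisj] at this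
    omega
  have hsum := Finset.card_eq_sum_card_fiberwise hφ
  obtain ⟨a, b, c, hab, hac, hbc, rfl⟩ := Finset.card_eq_three.1 hk
  rw [Finset.sum_insert (by simp [hab, hac]), Finset.sum_insert (by simp [hbc]),
    Finset.sum_singleton, hp] at hsum
  have ha := hL a (by simp)
  have hb := hL b (by simp)
  have hc := hL c (by simp)
  beta_reduce at ha hb hc
  have full : (lev a = 0 ∨ lev a = N) ∧ (lev b = 0 ∨ lev b = N) ∧ (lev c = 0 ∨ lev c = N) := by
    refine ⟨?_, ?_, ?_⟩ <;> by_contra h <;> split_ifs at ha hb hc <;> omega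
  obtain ⟨la, lb, lc⟩ := full
  rw [if_pos la] at ha
  rw [if_pos lb] at hb
  rw [if_pos lc] at hc
  have e₁ := pair a b hab
  have e₂ := pair a c hac
  have e₃ := pair b c hbc
  by_cases h : lev a = lev b
  · exact e₁ h la (by omega) (by omega)
  · by_cases h' : lev a = lev c
    · exact e₂ h' la (by omega) (by omega)
    · exact e₃ (by omega) lb (by omega) (by omega)

end Gap

/-- For every `r ≥ 2` there is a connected graphic instance together with
a set `S ⊆ ℱ` of pairwise distance at least 6 whose linear program is feasible, yet the
instance has no distance-`r` solution. -/
theorem integrality_gap_example (r : ℕ) (hr : 2 ≤ r) :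
    ∃ (n : ℕ) (G : SimpleGraph (Fin n)) (Cs Fs : Finset (Fin n))
      (L : Fin n → ℕ) (k p : ℕ) (S : Finset (Fin n)),
      IsGraphicInstance G Cs Fs ∧
      S ⊆ Fs ∧
      G.Connected ∧
      (∀ u ∈ S, ∀ u' ∈ S, u ≠ u' → 6 ≤ G.edist u u') ∧
      LPFeasible G Cs Fs L k p S ∧
      ¬ ∃ C F φ, IsSolution G Cs Fs L k p r C F φ := by
  obtain ⟨N, hN, hrN, hNe⟩ : ∃ N, 8 ≤ N ∧ r + 2 ≤ N ∧ Even N :=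
    ⟨2 * (r + 2), by omega, by omega, even_two_mul _⟩
  obtain ⟨n, lev, hle, hcard⟩ := exists_levels N
    (fun i => if i = 0 ∨ i = N then 2 else if i = 1 ∨ i = N - 1 then 3 * (N + 1) else 1)
  have h0 : (univ.filter fun v => lev v = 0).card = 2 := by
    rw [hcard 0 (by omega), if_pos (by omega)]
  have hNN : (univ.filter fun v => lev v = N).card = 2 := by
    rw [hcard N le_rfl, if_pos (by omega)]
  have h1 : (univ.filter fun v => lev v = 1).card = 3 * (N + 1) := by
    rw [hcard 1 (by omega), if_neg (by omega), if_pos (by omega)]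
  have hN1 : (univ.filter fun v => lev v = N - 1).card = 3 * (N + 1) := by
    rw [hcard (N - 1) (by omega), if_neg (by omega), if_pos (by omega)]
  have hmid : ∀ i, 2 ≤ i → i ≤ N - 2 → (univ.filter fun v => lev v = i).card = 1 := by
    intro i hi hi'
    rw [hcard i (by omega), if_neg (by omega), if_neg (by omega)]
  have hex : ∀ i ≤ N, ∃ v, lev v = i := by
    intro i hi
    have hpos : 0 < (univ.filter fun v => lev v = i).card := by
      rw [hcard i hi]
      split_ifs <;> omega
    obtain ⟨v, hv⟩ := Finset.card_pos.1 hpos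
    exact ⟨v, by simpa using hv⟩
  obtain ⟨a, ha⟩ := hex 0 (by omega)
  obtain ⟨b, hb⟩ := hex N le_rfl
  have hS : ∀ s ∈ ({a, b} : Finset (Fin n)), lev s = 0 ∨ lev s = N := by
    intro s hs
    rw [mem_insert, mem_singleton] at hs
    rcases hs with rfl | rfl
    · exact .inl ha
    · exact .inr hb
  refine ⟨n, levelGraph lev, univ.filter fun v => Odd (lev v), univ.filter fun v => Even (lev v),
    fun v => if lev v = 0 ∨ lev v = N then 2 * (N + 1) else 0, 3, 6 * (N + 1), {a, b},
    isGraphicInstance_levelGraph, ?_, levelGraph.connected (by omega) hle hex, ?_,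
    lpFeasible_levelGraph hN hNe (by omega) h0 h1 hN1 hNN hS, ?_⟩
  · intro s hs
    rw [mem_filter]
    refine ⟨mem_univ _, ?_⟩
    rcases hS s hs with h | h <;> rw [h]
    · exact Even.zero
    · exact hNe
  · intro u hu u' hu' hne
    by_contra hlt
    have hle5 : (levelGraph lev).edist u u' ≤ ((5 : ℕ) : ℕ∞) :=
      Order.le_of_lt_add_one (not_le.1 hlt)
    have := levelGraph.lev_le_add_of_edist_le hle5
    rw [mem_insert, mem_singleton] at hu hu'
    rcases hu with rfl | rfl <;> rcases hu' with rfl | rfl <;> first | exact hne rfl | omega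
  · rintro ⟨C, F, φ, h⟩
    exact not_isSolution_levelGraph hrN hNe (by omega) hle h1 hN1 hmid C F φ h
end

section
/- Let (G, L, k, p) be a graphic instance of capacitated k-supplier with outliers and define L' : ℱ → ℕ by L'(u) = min(L(u), deg_G(u)). Then: (a) the instance (G, L, k, p) admits a distance-1 solution if and only if the instance (G, L', k, p) does; and (b) for every r ≥ 1, every distance-r solution of (G, L', k, p) is a distance-r solution of (G, L, k, p). -/
open Finset

open scoped Classical

/-- The set of clients that a distance-1 solution assigns to a facility `u` has at most
`deg u` elements. -/
lemma IsSolution.card_fiber_le_degree {V : Type*} [Fintype V] [DecidableEq V]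
    {G : SimpleGraph V} [DecidableRel G.Adj] {Cs Fs : Finset V} {L : V → ℕ} {k p : ℕ}
    {C F : Finset V} {φ : V → V} (hdisj : Disjoint Cs Fs)
    (h : IsSolution G Cs Fs L k p 1 C F φ) {u : V} (hu : u ∈ F) :
    (C.filter (fun v => φ v = u)).card ≤ G.degree u := by
  obtain ⟨hC, hF, -, -, -, -, hdist⟩ := h
  rw [← G.card_neighborFinset_eq_degree]
  refine Finset.card_le_card fun v hv => ?_
  obtain ⟨hvC, rfl⟩ := Finset.mem_filter.mp hv
  rw [SimpleGraph.mem_neighborFinset]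
  have hle : G.edist v (φ v) ≤ 1 := by simpa using hdist v hvC
  rcases SimpleGraph.edist_le_one_iff_adj_or_eq.mp hle with hadj | heq
  · exact hadj.symm
  · exact absurd heq (Finset.disjoint_iff_ne.mp hdisj v (hC hvC) _ (hF hu))

/-- Being a solution is preserved when the capacities are replaced by ones that still bound
the loads of the open facilities. -/
lemma IsSolution.of_card_fiber_le {V : Type*} [Fintype V] [DecidableEq V]
    {G : SimpleGraph V} {Cs Fs : Finset V} {L L' : V → ℕ} {k p τ : ℕ}
    {C F : Finset V} {φ : V → V} (h : IsSolution G Cs Fs L k p τ C F φ)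
    (hload : ∀ u ∈ F, (C.filter (fun v => φ v = u)).card ≤ L' u) :
    IsSolution G Cs Fs L' k p τ C F φ := by
  obtain ⟨hC, hF, hp, hk, hφ, -, hdist⟩ := h
  exact ⟨hC, hF, hp, hk, hφ, hload, hdist⟩

/-- Truncating capacities at the degrees, `L'(u) = min(L(u), deg(u))`,
(a) preserves the existence of distance-1 solutions, and (b) creates no new distance-`r`
solutions for any `r ≥ 1`. -/
theorem capacity_truncation {V : Type*} [Fintype V] [DecidableEq V]
    (G : SimpleGraph V) [DecidableRel G.Adj] (Cs Fs : Finset V) (L : V → ℕ) (k p : ℕ)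
    (hinst : IsGraphicInstance G Cs Fs)
    (L' : V → ℕ) (hL' : ∀ u ∈ Fs, L' u = min (L u) (G.degree u)) :
    ((∃ C F φ, IsSolution G Cs Fs L k p 1 C F φ) ↔
      (∃ C F φ, IsSolution G Cs Fs L' k p 1 C F φ)) ∧
    (∀ r : ℕ, 1 ≤ r → ∀ C F φ,
      IsSolution G Cs Fs L' k p r C F φ → IsSolution G Cs Fs L k p r C F φ) := by
  have hmono : ∀ r : ℕ, ∀ C F φ,
      IsSolution G Cs Fs L' k p r C F φ → IsSolution G Cs Fs L k p r C F φ := by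
    intro r C F φ h
    refine h.of_card_fiber_le fun u hu => ?_
    obtain ⟨-, hF, -, -, -, hcap, -⟩ := h
    exact (hcap u hu).trans ((hL' u (hF hu)).le.trans (min_le_left _ _))
  refine ⟨⟨?_, fun ⟨C, F, φ, h⟩ => ⟨C, F, φ, hmono 1 C F φ h⟩⟩, fun r _ => hmono r⟩
  rintro ⟨C, F, φ, h⟩
  refine ⟨C, F, φ, h.of_card_fiber_le fun u hu => ?_⟩
  have hdeg := h.card_fiber_le_degree hinst.1 hu
  obtain ⟨-, hF, -, -, -, hcap, -⟩ := h
  rw [hL' u (hF hu)]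
  exact le_min (hcap u hu) hdeg
end
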